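/- arXiv:1209.3530 — 4 statements merged into one kernel-verified Lean document; each statement's English description precedes it below -/
import Mathlib

section
/- Every closed, countably generated left ideal in a Banach algebra is finitely generated. -/
noncomputable section

/-- A left ideal of an algebra `A`, encoded as a `ℂ`-submodule closed under
left multiplication by arbitrary elements of `A`. -/
def IsLeftIdeal {A : Type*} [NonUnitalNonAssocSemiring A] [Module ℂ A]
    (I : Submodule ℂ A) : Prop :=
  ∀ a : A, ∀ x ∈ I, a * x ∈ I

/-- The left ideal generated by a set `S` (equivalently `⟨S⟩ = A♯·S`). -/
def leftIdealGen {A : Type*} [NonUnitalNonAssocSemiring A] [Module ℂ A]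
    (S : Set A) : Submodule ℂ A :=
  sInf {I : Submodule ℂ A | IsLeftIdeal I ∧ S ⊆ ↑I}

/-- A left ideal is finitely generated if it is generated by a finite subset of itself. -/
def IsFGLeftIdeal {A : Type*} [NonUnitalNonAssocSemiring A] [Module ℂ A]
    (I : Submodule ℂ A) : Prop :=
  ∃ S : Finset A, ↑S ⊆ (I : Set A) ∧ leftIdealGen (↑S : Set A) = I

/-- A left ideal is countably generated if it is generated by a countable subset of itself. -/
def IsCGLeftIdeal {A : Type*} [NonUnitalNonAssocSemiring A] [Module ℂ A]
    (I : Submodule ℂ A) : Prop :=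
  ∃ S : Set A, S.Countable ∧ S ⊆ (I : Set A) ∧ leftIdealGen S = I

/-- Membership in `𝔐∞(A)`: a maximal element of the family of
non-finitely-generated left ideals. -/
def IsMaxNonFG {A : Type*} [NonUnitalNonAssocSemiring A] [Module ℂ A]
    (M : Submodule ℂ A) : Prop :=
  IsLeftIdeal M ∧ ¬ IsFGLeftIdeal M ∧
    ∀ J : Submodule ℂ A, IsLeftIdeal J → ¬ IsFGLeftIdeal J → M ≤ J → J = M

/-- Membership in `𝔑∞(A)`: a maximal element of the family of
non-countably-generated left ideals. -/
def IsMaxNonCG {A : Type*} [NonUnitalNonAssocSemiring A] [Module ℂ A]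
    (M : Submodule ℂ A) : Prop :=
  IsLeftIdeal M ∧ ¬ IsCGLeftIdeal M ∧
    ∀ J : Submodule ℂ A, IsLeftIdeal J → ¬ IsCGLeftIdeal J → M ≤ J → J = M

/-- `M` is a maximal left ideal. -/
def IsMaxLeftIdeal {A : Type*} [NonUnitalNonAssocSemiring A] [Module ℂ A]
    (M : Submodule ℂ A) : Prop :=
  IsLeftIdeal M ∧ M ≠ ⊤ ∧ ∀ J : Submodule ℂ A, IsLeftIdeal J → M < J → J = ⊤

open Filter Topology BoundedContinuousFunction

/-- Operators close in norm to a surjective operator between Banach spaces are surjective. -/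
theorem eventually_surj_aux {E F : Type*} [NormedAddCommGroup E] [NormedSpace ℂ E]
    [CompleteSpace E] [NormedAddCommGroup F] [NormedSpace ℂ F] [CompleteSpace F]
    (T : E →L[ℂ] F) (hT : Function.Surjective T) (u : ℕ → E →L[ℂ] F)
    (hu : Tendsto u atTop (𝓝 T)) : ∃ N, Function.Surjective (u N) := by
  have hr : T.range = ⊤ := LinearMap.range_eq_top.2 hT
  have hpos := T.nonlinearRightInverseOfSurjective_nnnorm_pos hr
  set R := T.nonlinearRightInverseOfSurjective hr with hR
  have hpos' : (0 : ℝ) < (R.nnnorm⁻¹ : NNReal) := by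
    exact_mod_cast inv_pos.2 hpos
  obtain ⟨N, hN⟩ := ((Metric.tendsto_nhds.1 hu) _ hpos').exists
  refine ⟨N, ?_⟩
  have happ : ApproximatesLinearOn (u N) T Set.univ ‖u N - T‖₊ := by
    intro x _ y _
    have : u N x - u N y - T (x - y) = (u N - T) (x - y) := by simp
    rw [this]
    exact (u N - T).le_opNorm _
  have hopen := happ.open_image R isOpen_univ (Or.inr (by
    rw [dist_eq_norm] at hN
    exact_mod_cast hN))
  rw [Set.image_univ] at hopen
  have htop : (u N).range = ⊤ := by
    apply Submodule.eq_top_of_nonempty_interior'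
    have h2 : (((u N).range : Submodule ℂ F) : Set F) = Set.range (u N) := by
      ext; simp
    rw [h2, hopen.interior_eq]
    exact ⟨_, 0, rfl⟩
  exact LinearMap.range_eq_top.1 htop

/-- Any sequence in a Banach space can be rescaled to a summable one. -/
theorem exists_summable_aux {V : Type*} [NormedAddCommGroup V] [NormedSpace ℂ V]
    [CompleteSpace V] (L : ℕ → V) : ∃ c : ℕ → ℂ, (∀ n, c n ≠ 0) ∧ Summable fun n => c n • L n := by
  refine ⟨fun n => (((1 / 2 : ℝ) ^ n / (1 + ‖L n‖) : ℝ) : ℂ), fun n => ?_, ?_⟩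
  · have : (0 : ℝ) < (1 / 2 : ℝ) ^ n / (1 + ‖L n‖) := by positivity
    exact Complex.ofReal_ne_zero.2 this.ne'
  · refine Summable.of_norm_bounded (g := fun n => (1 / 2 : ℝ) ^ n)
      summable_geometric_two fun n => ?_
    have h1 : (0 : ℝ) ≤ (1 / 2 : ℝ) ^ n / (1 + ‖L n‖) := by positivity
    rw [norm_smul, Complex.norm_real, Real.norm_of_nonneg h1, div_mul_eq_mul_div,
      div_le_iff₀ (by positivity)]
    gcongr
    linarith

/-- The generated left ideal is a left ideal. -/
theorem leftIdealGen_isLeftIdeal {A : Type*} [NonUnitalNormedRing A] [NormedSpace ℂ A]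
    (S : Set A) : IsLeftIdeal (leftIdealGen S) := by
  intro a x hx
  simp only [leftIdealGen, Submodule.mem_sInf] at hx ⊢
  intro J hJ
  exact hJ.1 a x (hx J hJ)

theorem subset_leftIdealGen_aux {A : Type*} [NonUnitalNormedRing A] [NormedSpace ℂ A]
    (S : Set A) : S ⊆ (leftIdealGen S : Set A) := by
  intro x hx
  simp only [leftIdealGen, SetLike.mem_coe, Submodule.mem_sInf]
  intro J hJ
  exact hJ.2 hx

theorem leftIdealGen_le_aux {A : Type*} [NonUnitalNormedRing A] [NormedSpace ℂ A]
    {S : Set A} {J : Submodule ℂ A} (h1 : IsLeftIdeal J) (h2 : S ⊆ J) : leftIdealGen S ≤ J :=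
  sInf_le ⟨h1, h2⟩

section

variable {A : Type*} [NonUnitalNormedRing A] [NormedSpace ℂ A]
    [IsScalarTower ℂ A A] [SMulCommClass ℂ A A]

/-- The map `(l, a) ↦ l s + a s`. -/
def phiAux (s : A) : ℂ × A →L[ℂ] A :=
  (ContinuousLinearMap.fst ℂ ℂ A).smulRight s +
    ((ContinuousLinearMap.mul ℂ A).flip s).comp (ContinuousLinearMap.snd ℂ ℂ A)

theorem phiAux_apply (s : A) (p : ℂ × A) : phiAux s p = p.1 • s + p.2 * s := by
  simp [phiAux]

/-- The left action of `a` on the unitization. -/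
def actAux (a : A) : ℂ × A →L[ℂ] ℂ × A :=
  (0 : ℂ × A →L[ℂ] ℂ).prod ((ContinuousLinearMap.fst ℂ ℂ A).smulRight a +
    (ContinuousLinearMap.mul ℂ A a).comp (ContinuousLinearMap.snd ℂ ℂ A))

theorem phiAux_actAux (s a : A) (p : ℂ × A) : phiAux s (actAux a p) = a * phiAux s p := by
  simp [phiAux, actAux, mul_add, add_mul, mul_assoc, mul_smul_comm, smul_mul_assoc]

end

/-- Every closed, countably generated left ideal in a Banach
algebra is finitely generated. -/
theorem closed_cg_implies_fg {A : Type*} [NonUnitalNormedRing A] [NormedSpace ℂ A]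
    [IsScalarTower ℂ A A] [SMulCommClass ℂ A A] [CompleteSpace A]
    (I : Submodule ℂ A) (hI : IsLeftIdeal I) (hcl : IsClosed (I : Set A))
    (hcg : IsCGLeftIdeal I) :
    IsFGLeftIdeal I := by
  obtain ⟨S, hSc, hSI, hS⟩ := hcg
  rcases S.eq_empty_or_nonempty with rfl | hne
  · exact ⟨∅, by simp, by simpa using hS⟩
  obtain ⟨s, rfl⟩ := hSc.exists_eq_range hne
  have hsI : ∀ n, s n ∈ I := fun n => hSI ⟨n, rfl⟩
  haveI : CompleteSpace I := hcl.completeSpace_coe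
  have hphi : ∀ n (p : ℂ × A), phiAux (s n) p ∈ I := fun n p => by
    rw [phiAux_apply]
    exact I.add_mem (I.smul_mem _ (hsI n)) (hI _ _ (hsI n))
  let L : ℕ → (ℕ →ᵇ ℂ × A) →L[ℂ] I := fun n =>
    ((phiAux (s n)).codRestrict I (hphi n)).comp (BoundedContinuousFunction.evalCLM ℂ n)
  have hL : ∀ n x, (L n x : A) = phiAux (s n) (x n) := fun n x => rfl
  clear_value L
  obtain ⟨c, hc0, hsum⟩ := exists_summable_aux L
  obtain ⟨T, hT⟩ := hsum
  have hTx : ∀ x, HasSum (fun n => c n • phiAux (s n) (x n)) (T x : A) := fun x => by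
    have h1 := hT.mapL (ContinuousLinearMap.apply ℂ I x)
    have h2 := h1.mapL I.subtypeL
    simpa [hL] using h2
  have hsurj : Function.Surjective T := by
    have hJ : IsLeftIdeal ((I.subtype.comp (T : (ℕ →ᵇ ℂ × A) →ₗ[ℂ] I)).range) := by
      rintro a _ ⟨x, rfl⟩
      refine ⟨(actAux a).compLeftContinuousBounded ℕ x, ?_⟩
      have h1 := hTx ((actAux a).compLeftContinuousBounded ℕ x)
      have h2 := (hTx x).mul_left a
      simp only [ContinuousLinearMap.compLeftContinuousBounded_apply, phiAux_actAux] at h1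
      simp only [mul_smul_comm] at h2
      exact h1.unique h2
    have hle : leftIdealGen (Set.range s) ≤
        ((I.subtype.comp (T : (ℕ →ᵇ ℂ × A) →ₗ[ℂ] I)).range) := by
      refine leftIdealGen_le_aux hJ ?_
      rintro _ ⟨n, rfl⟩
      let x : ℕ →ᵇ ℂ × A := BoundedContinuousFunction.ofNormedAddCommGroupDiscrete
        (Pi.single n (((c n)⁻¹, 0) : ℂ × A)) ‖(((c n)⁻¹, 0) : ℂ × A)‖ (fun m => by
          by_cases h : m = n
          · subst h; simp
          · rw [Pi.single_eq_of_ne h, norm_zero]; exact norm_nonneg _)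
      refine ⟨x, ?_⟩
      have hxn : x n = ((c n)⁻¹, 0) := Pi.single_eq_same _ _
      have h1 := hTx x
      have h2 := hasSum_single (f := fun m => c m • phiAux (s m) (x m)) n (fun m hm => by
        have hxm : x m = 0 := Pi.single_eq_of_ne hm _
        simp [hxm])
      have h3 := h1.unique h2
      rw [hxn, phiAux_apply] at h3
      simp only [zero_mul, add_zero, smul_smul, mul_inv_cancel₀ (hc0 n), one_smul] at h3
      exact h3
    intro y
    have hy : (y : A) ∈ leftIdealGen (Set.range s) := by rw [hS]; exact y.2
    obtain ⟨x, hx⟩ := hle hy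
    exact ⟨x, Subtype.ext hx⟩
  obtain ⟨N, hN⟩ := eventually_surj_aux T hsurj _ hT.tendsto_sum_nat
  classical
  refine ⟨(Finset.range N).image s, ?_, le_antisymm ?_ ?_⟩
  · intro a ha
    simp only [Finset.coe_image, Set.mem_image] at ha
    obtain ⟨n, _, rfl⟩ := ha
    exact hsI n
  · refine leftIdealGen_le_aux hI ?_
    intro a ha
    simp only [Finset.coe_image, Set.mem_image] at ha
    obtain ⟨n, _, rfl⟩ := ha
    exact hsI n
  · intro y hy
    obtain ⟨x, hx⟩ := hN ⟨y, hy⟩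
    have hx' := congrArg (Subtype.val) hx
    simp only [ContinuousLinearMap.sum_apply, ContinuousLinearMap.smul_apply,
      Submodule.coe_sum, Submodule.coe_smul, hL] at hx'
    rw [← hx']
    refine Submodule.sum_mem _ fun n hn => Submodule.smul_mem _ _ ?_
    have hmem : s n ∈ leftIdealGen (((Finset.range N).image s : Finset A) : Set A) :=
      subset_leftIdealGen_aux _ (Finset.mem_coe.2 (Finset.mem_image_of_mem s hn))
    rw [phiAux_apply]
    exact Submodule.add_mem _ (Submodule.smul_mem _ _ hmem)
      (leftIdealGen_isLeftIdeal _ _ _ hmem)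
end
end

section
/- Let A be a Banach algebra and let I be a left ideal of A that is not countably generated. Then there exists a closed left ideal N of A containing I that is maximal among left ideals of A that are not countably generated. -/
noncomputable section

section Helpers

set_option linter.unusedSectionVars false

variable {A : Type*} [NonUnitalNormedRing A] [NormedSpace ℂ A]
    [IsScalarTower ℂ A A] [SMulCommClass ℂ A A]

theorem isLeftIdeal_gen (S : Set A) : IsLeftIdeal (leftIdealGen S) := by
  intro a x hx
  unfold leftIdealGen at *
  rw [Submodule.mem_sInf] at *
  intro J hJ
  exact hJ.1 a x (hx J hJ)

theorem subset_gen (S : Set A) : S ⊆ (leftIdealGen S : Set A) := by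
  intro x hx
  unfold leftIdealGen
  rw [SetLike.mem_coe, Submodule.mem_sInf]
  intro J hJ
  exact hJ.2 hx

theorem gen_le {S : Set A} {J : Submodule ℂ A} (hJ : IsLeftIdeal J) (h : S ⊆ J) :
    leftIdealGen S ≤ J := sInf_le ⟨hJ, h⟩

/-- The generated left ideal is contained in any subspace containing `S` and `A * S`. -/
theorem gen_le_subspace {S : Set A} {J : Submodule ℂ A} (h1 : S ⊆ J)
    (h2 : ∀ a : A, ∀ s ∈ S, a * s ∈ J) : leftIdealGen S ≤ J := by
  let T : Set A := S ∪ {z | ∃ a : A, ∃ s ∈ S, z = a * s}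
  have hT : IsLeftIdeal (Submodule.span ℂ T) := by
    intro a x hx
    induction hx using Submodule.span_induction with
    | mem x hx =>
      apply Submodule.subset_span
      rcases hx with hx | ⟨b, s, hs, rfl⟩
      · exact Or.inr ⟨a, x, hx, rfl⟩
      · exact Or.inr ⟨a * b, s, hs, (mul_assoc _ _ _).symm⟩
    | zero => simp
    | add x y _ _ hx hy => rw [mul_add]; exact add_mem hx hy
    | smul c x _ hx => rw [mul_smul_comm]; exact Submodule.smul_mem _ _ hx
  refine (gen_le hT (fun s hs => Submodule.subset_span (Or.inl hs))).trans ?_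
  rw [Submodule.span_le]
  rintro z (hz | ⟨a, s, hs, rfl⟩)
  · exact h1 hz
  · exact h2 a s hs

theorem isLeftIdeal_closure {J : Submodule ℂ A} (hJ : IsLeftIdeal J) :
    IsLeftIdeal J.topologicalClosure := by
  intro a x hx
  exact map_mem_closure (f := fun y => a * y) (by fun_prop) hx (fun y hy => hJ a y hy)

variable [CompleteSpace A]

theorem term_bound (p : ℂ × A) (x : A) (c : ℝ) (hx : ‖x‖ ≤ c) :
    ‖p.1 • x + p.2 * x‖ ≤ 2 * c * ‖p‖ := by
  have h1 : ‖p.1‖ ≤ ‖p‖ := norm_fst_le p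
  have h2 : ‖p.2‖ ≤ ‖p‖ := norm_snd_le p
  calc ‖p.1 • x + p.2 * x‖ ≤ ‖p.1 • x‖ + ‖p.2 * x‖ := norm_add_le _ _
    _ ≤ ‖p.1‖ * ‖x‖ + ‖p.2‖ * ‖x‖ := add_le_add (norm_smul_le _ _) (norm_mul_le _ _)
    _ ≤ ‖p‖ * c + ‖p‖ * c := by gcongr
    _ = _ := by ring

theorem lp_summable (f : lp (fun _ : ℕ => ℂ × A) 1) : Summable (fun i => ‖f i‖) := by
  simpa using f.2.summable

theorem lp_norm (f : lp (fun _ : ℕ => ℂ × A) 1) : ‖f‖ = ∑' i, ‖f i‖ := by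
  rw [lp.norm_eq_tsum_rpow (by simp)]
  simp

theorem sum_term (x : ℕ → A) (c : ℝ) (hx : ∀ i, ‖x i‖ ≤ c)
    (f : lp (fun _ : ℕ => ℂ × A) 1) :
    Summable (fun i => (f i).1 • x i + (f i).2 * x i) :=
  Summable.of_norm_bounded ((lp_summable f).mul_left (2 * c))
    (fun i => term_bound _ _ _ (hx i))

theorem norm_sum_term (x : ℕ → A) (c : ℝ) (hx : ∀ i, ‖x i‖ ≤ c)
    (f : lp (fun _ : ℕ => ℂ × A) 1) :
    ‖∑' i, ((f i).1 • x i + (f i).2 * x i)‖ ≤ 2 * c * ‖f‖ := by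
  rw [lp_norm, ← tsum_mul_left]
  exact tsum_of_norm_bounded ((lp_summable f).mul_left (2 * c)).hasSum
    (fun i => term_bound _ _ _ (hx i))

/-- The operator `(a_i) ↦ ∑ a_i x_i` from `ℓ¹(A♯)` to `K`. -/
def sumOp (K : Submodule ℂ A) (hK : IsLeftIdeal K) (hc : IsClosed (K : Set A)) (x : ℕ → A)
    (c : ℝ) (hx : ∀ i, ‖x i‖ ≤ c) (hxK : ∀ i, x i ∈ K) :
    lp (fun _ : ℕ => ℂ × A) 1 →L[ℂ] K :=
  LinearMap.mkContinuous
    { toFun := fun f => ⟨∑' i, ((f i).1 • x i + (f i).2 * x i), by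
        refine hc.mem_of_tendsto (sum_term x c hx f).hasSum (Filter.Eventually.of_forall ?_)
        intro s
        exact K.sum_mem fun i _ => K.add_mem (K.smul_mem _ (hxK i)) (hK _ _ (hxK i))⟩
      map_add' := by
        intro f g
        ext
        simp only [Submodule.coe_add]
        rw [← (sum_term x c hx f).tsum_add (sum_term x c hx g)]
        refine tsum_congr fun i => ?_
        simp [add_smul, add_mul]
        abel
      map_smul' := by
        intro r f
        ext
        simp only [Submodule.coe_smul, RingHom.id_apply]
        rw [← (sum_term x c hx f).tsum_const_smul]
        refine tsum_congr fun i => ?_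
        simp [smul_smul, smul_mul_assoc] }
    (2 * c) (fun f => norm_sum_term x c hx f)

theorem sumOp_apply (K : Submodule ℂ A) (hK : IsLeftIdeal K) (hc : IsClosed (K : Set A))
    (x : ℕ → A) (c : ℝ) (hx : ∀ i, ‖x i‖ ≤ c) (hxK : ∀ i, x i ∈ K)
    (f : lp (fun _ : ℕ => ℂ × A) 1) :
    (sumOp K hK hc x c hx hxK f : A) = ∑' i, ((f i).1 • x i + (f i).2 * x i) := rfl

theorem sumOp_single (K : Submodule ℂ A) (hK : IsLeftIdeal K) (hc : IsClosed (K : Set A))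
    (x : ℕ → A) (c : ℝ) (hx : ∀ i, ‖x i‖ ≤ c) (hxK : ∀ i, x i ∈ K) (i : ℕ) (p : ℂ × A) :
    (sumOp K hK hc x c hx hxK (lp.single 1 i p) : A) = p.1 • x i + p.2 * x i := by
  rw [sumOp_apply, tsum_eq_single i]
  · simp
  · intro j hj
    rw [lp.single_apply_ne _ _ _ hj]
    simp

/-- If the closure of `J` is countably generated, it is generated by finitely many elements
of `J`. -/
theorem key {J : Submodule ℂ A} (hJ : IsLeftIdeal J)
    (hcg : IsCGLeftIdeal J.topologicalClosure) :
    ∃ F : Set A, F.Finite ∧ F ⊆ J ∧ J.topologicalClosure ≤ leftIdealGen F := by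
  obtain ⟨S, hS, hSK, hgen⟩ := hcg
  set K := J.topologicalClosure with hKdef
  have hK : IsLeftIdeal K := isLeftIdeal_closure hJ
  have hc : IsClosed (K : Set A) := J.isClosed_topologicalClosure
  obtain ⟨s, hs⟩ := (hS.insert 0).exists_eq_range (Set.insert_nonempty 0 S)
  have hsK : ∀ i, s i ∈ K := by
    intro i
    have : s i ∈ insert 0 S := hs ▸ Set.mem_range_self i
    rcases this with h | h
    · rw [h]; exact K.zero_mem
    · exact hSK h
  let r : ℕ → ℝ := fun i => 1 / ((i + 1 : ℝ) * (1 + ‖s i‖))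
  have hr : ∀ i, 0 < r i := fun i => by positivity
  let x : ℕ → A := fun i => (r i : ℂ) • s i
  have hxK : ∀ i, x i ∈ K := fun i => K.smul_mem _ (hsK i)
  have hxn : ∀ i : ℕ, ‖x i‖ ≤ 1 / (i + 1 : ℝ) := by
    intro i
    have h0 := norm_nonneg (s i)
    simp only [x, norm_smul, Complex.norm_real, Real.norm_eq_abs, abs_of_pos (hr i), r]
    rw [div_mul_eq_mul_div, one_mul, div_le_div_iff₀ (by positivity) (by positivity)]
    have : (0 : ℝ) ≤ i := Nat.cast_nonneg i
    nlinarith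
  have hx1 : ∀ i, ‖x i‖ ≤ 1 := by
    intro i
    refine (hxn i).trans ?_
    rw [div_le_one (by positivity)]
    have : (0 : ℝ) ≤ i := Nat.cast_nonneg i
    linarith
  have : CompleteSpace K := hc.completeSpace_coe
  let T := sumOp K hK hc x 1 hx1 hxK
  have hT : T.range = ⊤ := by
    have hle : K ≤ Submodule.map K.subtype T.range := by
      refine hgen.symm.le.trans ?_
      have hmem : ∀ t ∈ S, ∃ i, s i = t := by
        intro t ht
        have : t ∈ Set.range s := hs ▸ Set.mem_insert_of_mem _ ht
        exact this
      have hne : ∀ i, (r i : ℂ) ≠ 0 := fun i => by exact_mod_cast (hr i).ne'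
      apply gen_le_subspace
      · intro t ht
        obtain ⟨i, rfl⟩ := hmem t ht
        refine ⟨_, ⟨lp.single 1 i ((r i : ℂ)⁻¹, 0), rfl⟩, ?_⟩
        refine (sumOp_single K hK hc x 1 hx1 hxK i _).trans ?_
        simp only [x, smul_smul, inv_mul_cancel₀ (hne i), one_smul, zero_mul, add_zero]
      · intro a t ht
        obtain ⟨i, rfl⟩ := hmem t ht
        refine ⟨_, ⟨lp.single 1 i (0, (r i : ℂ)⁻¹ • a), rfl⟩, ?_⟩
        refine (sumOp_single K hK hc x 1 hx1 hxK i _).trans ?_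
        simp only [x, smul_mul_assoc, mul_smul_comm, smul_smul, zero_mul,
          mul_inv_cancel₀ (hne i), one_smul, zero_smul, zero_add]
    rw [eq_top_iff]
    rintro ⟨y, hy⟩ -
    obtain ⟨z, hz, hzy⟩ := hle hy
    have : z = ⟨y, hy⟩ := Subtype.ext hzy
    exact this ▸ hz
  let R := T.nonlinearRightInverseOfSurjective hT
  have hR : 0 < R.nnnorm := T.nonlinearRightInverseOfSurjective_nnnorm_pos hT
  obtain ⟨δ, hδ, hδR⟩ : ∃ δ : ℝ, 0 < δ ∧ 2 * δ < (R.nnnorm : ℝ)⁻¹ := by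
    have : 0 < (R.nnnorm : ℝ)⁻¹ := by positivity
    exact ⟨(R.nnnorm : ℝ)⁻¹ / 4, by positivity, by linarith⟩
  obtain ⟨N, hN⟩ := exists_nat_one_div_lt hδ
  have hy : ∀ i, ∃ y ∈ J, ‖y - x i‖ ≤ δ ∧ (N ≤ i → y = 0) := by
    intro i
    by_cases hi : N ≤ i
    · refine ⟨0, J.zero_mem, ?_, fun _ => rfl⟩
      rw [zero_sub, norm_neg]
      refine (hxn i).trans (le_trans ?_ hN.le)
      gcongr
    · obtain ⟨y, hy, hd⟩ := Metric.mem_closure_iff.1 (hxK i) δ hδ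
      refine ⟨y, hy, ?_, fun h => absurd h hi⟩
      rw [← dist_eq_norm, dist_comm]
      exact hd.le
  choose y hyJ hyx hy0 using hy
  have hyK : ∀ i, y i ∈ K := fun i => J.le_topologicalClosure (hyJ i)
  have hyn : ∀ i, ‖y i‖ ≤ δ + 1 := by
    intro i
    calc ‖y i‖ = ‖(y i - x i) + x i‖ := by rw [sub_add_cancel]
      _ ≤ _ := norm_add_le_of_le (hyx i) (hx1 i)
  let U := sumOp K hK hc y (δ + 1) hyn hyK
  have hdiff : ∀ f, ‖U f - T f‖ ≤ 2 * δ * ‖f‖ := by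
    intro f
    have h := norm_sum_term (fun i => y i - x i) δ hyx f
    have e : ((U f - T f : K) : A) =
        ∑' i, ((f i).1 • (y i - x i) + (f i).2 * (y i - x i)) := by
      rw [Submodule.coe_sub]
      refine ((sum_term y _ hyn f).tsum_sub (sum_term x _ hx1 f)).symm.trans ?_
      refine tsum_congr fun i => ?_
      rw [smul_sub, mul_sub]
      abel
    rw [← e] at h
    exact h
  have happ : ApproximatesLinearOn U T Set.univ ⟨2 * δ, by positivity⟩ := by
    intro f _ g _
    rw [← map_sub]
    exact hdiff _
  refine ⟨y '' Set.Iio N, (Set.finite_Iio N).image y, ?_, ?_⟩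
  · rintro _ ⟨i, -, rfl⟩
    exact hyJ i
  · intro z hz
    have hpos : 0 < (R.nnnorm : ℝ)⁻¹ - 2 * δ := by linarith
    obtain ⟨f, -, hf⟩ := happ.surjOn_closedBall_of_nonlinearRightInverse R
      (ε := ‖z‖ / ((R.nnnorm : ℝ)⁻¹ - 2 * δ)) (b := 0) (by positivity) (Set.subset_univ _)
      (show (⟨z, hz⟩ : K) ∈ _ by
        rw [map_zero, mem_closedBall_zero_iff]
        change ‖z‖ ≤ ((R.nnnorm : ℝ)⁻¹ - 2 * δ) * _
        rw [mul_div_cancel₀ _ hpos.ne'])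
    have hz' : z = ∑' i, ((f i).1 • y i + (f i).2 * y i) := (congrArg Subtype.val hf).symm
    rw [hz', tsum_eq_sum (s := Finset.range N)]
    · refine Submodule.sum_mem _ fun i hi => ?_
      have hi' : y i ∈ leftIdealGen (y '' Set.Iio N) :=
        subset_gen _ ⟨i, Finset.mem_range.1 hi, rfl⟩
      exact Submodule.add_mem _ (Submodule.smul_mem _ _ hi') (isLeftIdeal_gen _ _ _ hi')
    · intro i hi
      rw [hy0 i (by simpa using hi)]
      simp

end Helpers

/-- In a Banach algebra, every left ideal that is not countably
generated is contained in a closed left ideal that is maximal among the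
non-countably-generated left ideals. -/
theorem exists_maximal_nonCG {A : Type*} [NonUnitalNormedRing A] [NormedSpace ℂ A]
    [IsScalarTower ℂ A A] [SMulCommClass ℂ A A] [CompleteSpace A]
    (I : Submodule ℂ A) (hI : IsLeftIdeal I) (hncg : ¬ IsCGLeftIdeal I) :
    ∃ N : Submodule ℂ A, I ≤ N ∧ IsClosed (N : Set A) ∧ IsMaxNonCG N := by
  classical
  have hmain : ∀ J : Submodule ℂ A, IsLeftIdeal J → ¬ IsCGLeftIdeal J →
      ¬ IsCGLeftIdeal J.topologicalClosure := by
    intro J hJ hn hcg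
    obtain ⟨F, hF, hFJ, hle⟩ := key hJ hcg
    exact hn ⟨F, hF.countable, hFJ,
      le_antisymm (gen_le hJ hFJ) (J.le_topologicalClosure.trans hle)⟩
  obtain ⟨N, hIN, hN⟩ := zorn_le_nonempty₀
    {J : Submodule ℂ A | IsLeftIdeal J ∧ ¬ IsCGLeftIdeal J} (by
      intro c hcs hch y hy
      have hdir : DirectedOn (· ≤ ·) c := hch.directedOn
      have hmem : ∀ z, z ∈ sSup c ↔ ∃ J ∈ c, z ∈ J := fun z =>
        Submodule.mem_sSup_of_directed ⟨y, hy⟩ hdir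
      have hL : IsLeftIdeal (sSup c) := by
        intro a x hx
        obtain ⟨J, hJ, hxJ⟩ := (hmem x).1 hx
        exact (hmem _).2 ⟨J, hJ, (hcs hJ).1 a x hxJ⟩
      refine ⟨(sSup c).topologicalClosure, ⟨isLeftIdeal_closure hL, ?_⟩,
        fun z hz => (le_sSup hz).trans (Submodule.le_topologicalClosure _)⟩
      intro hcg
      obtain ⟨F, hF, hFJ, hle⟩ := key hL hcg
      have hex : ∃ J ∈ c, F ⊆ (J : Set A) := by
        clear hle
        induction F, hF using Set.Finite.induction_on with
        | empty => exact ⟨y, hy, Set.empty_subset _⟩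
        | @insert a F _ _ ih =>
          obtain ⟨J, hJ, hFJ'⟩ := ih ((Set.subset_insert _ _).trans hFJ)
          obtain ⟨J', hJ', ha⟩ := (hmem a).1 (hFJ (Set.mem_insert _ _))
          obtain ⟨L, hLc, h1, h2⟩ := hdir J hJ J' hJ'
          exact ⟨L, hLc, Set.insert_subset (h2 ha) (hFJ'.trans h1)⟩
      obtain ⟨J, hJ, hFJ'⟩ := hex
      refine (hcs hJ).2 ⟨F, hF.countable, hFJ', le_antisymm (gen_le (hcs hJ).1 hFJ') ?_⟩
      exact (le_sSup hJ).trans ((Submodule.le_topologicalClosure _).trans hle))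
    I ⟨hI, hncg⟩
  refine ⟨N, hIN, ?_, hN.1.1, hN.1.2, fun J hJ hn hle => le_antisymm (hN.2 ⟨hJ, hn⟩ hle) hle⟩
  have h : N.topologicalClosure ≤ N :=
    hN.2 ⟨isLeftIdeal_closure hN.1.1, hmain N hN.1.1 hN.1.2⟩ N.le_topologicalClosure
  have e : N.topologicalClosure = N := le_antisymm h N.le_topologicalClosure
  rw [← e]
  exact N.isClosed_topologicalClosure
end
end

section
/- Let A be a unital algebra and let K be a two-sided ideal of A of finite codimension. Suppose each maximal left ideal of A containing K is finitely generated as a left ideal of A. Then K is finitely generated as a left ideal of A. -/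
noncomputable section

/-- The `ℂ`-submodule `I` is a left ideal; view it as an `Ideal A`. -/
def toIdealAux {A : Type*} [Ring A] [Algebra ℂ A] (I : Submodule ℂ A) (h : IsLeftIdeal I) :
    Ideal A :=
  { I with smul_mem' := fun a x hx => h a x hx }

theorem leftIdealGen_eq_span {A : Type*} [Ring A] [Algebra ℂ A] (S : Set A) :
    leftIdealGen S = (Submodule.span A S).restrictScalars ℂ := by
  apply le_antisymm
  · apply sInf_le
    exact ⟨fun a x hx => Submodule.smul_mem (Submodule.span A S) a hx, Submodule.subset_span⟩
  · apply le_sInf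
    rintro I ⟨hI, hS⟩ x hx
    have h : Submodule.span A S ≤ toIdealAux I hI := Submodule.span_le.2 hS
    exact h hx

theorem isFGLeftIdeal_iff {A : Type*} [Ring A] [Algebra ℂ A] (I : Ideal A) :
    IsFGLeftIdeal (I.restrictScalars ℂ) ↔ I.FG := by
  constructor
  · rintro ⟨S, -, h⟩
    rw [leftIdealGen_eq_span] at h
    exact ⟨S, Submodule.restrictScalars_injective ℂ A A h⟩
  · rintro ⟨S, h⟩
    refine ⟨S, ?_, ?_⟩
    · rw [← h]
      exact Submodule.subset_span
    · rw [leftIdealGen_eq_span, ← h]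

theorem isMaxLeftIdeal_of_isMaximal {A : Type*} [Ring A] [Algebra ℂ A] (I : Ideal A)
    (hI : I.IsMaximal) : IsMaxLeftIdeal (I.restrictScalars ℂ) := by
  refine ⟨fun a x hx => I.mul_mem_left a hx, ?_, ?_⟩
  · intro h
    exact hI.ne_top ((Submodule.restrictScalars_eq_top_iff ℂ A A).1 h)
  · intro J hJ hlt
    have h : I < toIdealAux J hJ := hlt
    have h2 := hI.1.2 _ h
    rw [eq_top_iff]
    intro x _
    have : x ∈ toIdealAux J hJ := by rw [h2]; trivial
    exact this

/-- A finite length module killed by `K` is finitely presented when all maximal left ideals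
containing `K` are finitely generated. -/
theorem finitePresentation_of_isFiniteLength {A : Type*} [Ring A] (K : Ideal A)
    (hmax : ∀ I : Ideal A, I.IsMaximal → K ≤ I → I.FG)
    {M : Type*} [AddCommGroup M] [Module A M] (h : IsFiniteLength A M)
    (hK : ∀ k ∈ K, ∀ m : M, k • m = 0) : Module.FinitePresentation A M := by
  induction h with
  | of_subsingleton => infer_instance
  | @of_simple_quotient M _ _ N hs _ ih =>
    have hN : Module.FinitePresentation A N :=
      ih fun k hk m => Subtype.ext (hK k hk m)
    obtain ⟨I, hI, ⟨e⟩⟩ := isSimpleModule_iff_quot_maximal.1 hs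
    have hKI : K ≤ I := by
      intro k hk
      obtain ⟨q, hq⟩ := e.surjective (Submodule.Quotient.mk (1 : A))
      obtain ⟨m, rfl⟩ := Submodule.Quotient.mk_surjective _ q
      have h0 : k • (Submodule.Quotient.mk (1 : A) : A ⧸ I) = 0 := by
        rw [← hq, ← map_smul, ← Submodule.Quotient.mk_smul, hK k hk m,
          Submodule.Quotient.mk_zero, map_zero]
      rw [← Submodule.Quotient.mk_smul, Submodule.Quotient.mk_eq_zero] at h0
      simpa using h0
    have hQ : Module.FinitePresentation A (A ⧸ I) :=
      Module.finitePresentation_of_surjective (Submodule.mkQ I) (Submodule.mkQ_surjective I)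
        (by rw [Submodule.ker_mkQ]; exact hmax I hI hKI)
    have hQ2 : Module.FinitePresentation A (M ⧸ N) := .of_equiv e.symm
    have hN2 : Module.FinitePresentation A (LinearMap.ker N.mkQ) := by
      rw [Submodule.ker_mkQ]; exact hN
    exact Module.finitePresentation_of_ker N.mkQ N.mkQ_surjective

/-- Lemma 1.10. Let `A` be a unital algebra and `K` a two-sided
ideal of finite codimension. If every maximal left ideal of `A` containing `K` is
finitely generated as a left ideal, then `K` is finitely generated as a left ideal. -/
theorem fg_of_finite_codim {A : Type*} [Ring A] [Algebra ℂ A]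
    (K : Submodule ℂ A) (hKl : IsLeftIdeal K) (hKr : ∀ x ∈ K, ∀ a : A, x * a ∈ K)
    (hcodim : FiniteDimensional ℂ (A ⧸ K))
    (hmax : ∀ M : Submodule ℂ A, IsMaxLeftIdeal M → K ≤ M → IsFGLeftIdeal M) :
    IsFGLeftIdeal K := by
  let K' : Ideal A := toIdealAux K hKl
  have hKK : K'.restrictScalars ℂ = K := rfl
  have hfin0 : Module.Finite ℂ (A ⧸ K'.restrictScalars ℂ) := hcodim
  have hfin : FiniteDimensional ℂ (A ⧸ K') :=
    Module.Finite.equiv (Submodule.Quotient.restrictScalarsEquiv ℂ K')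
  have hlen : IsFiniteLength A (A ⧸ K') :=
    isFiniteLength_iff_isNoetherian_isArtinian.2
      ⟨isNoetherian_of_tower ℂ inferInstance, isArtinian_of_tower ℂ inferInstance⟩
  have hfp : Module.FinitePresentation A (A ⧸ K') := by
    refine finitePresentation_of_isFiniteLength K' ?_ hlen ?_
    · intro I hI hle
      exact (isFGLeftIdeal_iff I).1 (hmax _ (isMaxLeftIdeal_of_isMaximal I hI) hle)
    · intro k hk m
      obtain ⟨a, rfl⟩ := Submodule.Quotient.mk_surjective _ m
      rw [← Submodule.Quotient.mk_smul, Submodule.Quotient.mk_eq_zero]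
      exact hKr k hk a
  have hfg := Module.FinitePresentation.fg_ker (Submodule.mkQ K') (Submodule.mkQ_surjective K')
  rw [Submodule.ker_mkQ] at hfg
  rw [← hKK]
  exact (isFGLeftIdeal_iff K').2 hfg
end
end

section
/- Let A be a commutative, unital Banach algebra in which every maximal ideal is countably generated. Then A is finite-dimensional over ℂ. -/
noncomputable section

theorem surj_open {E F : Type*} [NormedAddCommGroup E] [NormedSpace ℂ E] [CompleteSpace E]
    [NormedAddCommGroup F] [NormedSpace ℂ F] [CompleteSpace F] (T : E →L[ℂ] F)
    (hT : Function.Surjective T) :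
    ∃ ε > 0, ∀ T' : E →L[ℂ] F, ‖T' - T‖ < ε → Function.Surjective T' := by
  have hr : T.range = ⊤ := LinearMap.range_eq_top.2 hT
  set g := T.nonlinearRightInverseOfSurjective hr
  have hg : 0 < g.nnnorm := T.nonlinearRightInverseOfSurjective_nnnorm_pos hr
  have hg' : (0:ℝ) < (g.nnnorm : ℝ)⁻¹ := by positivity
  refine ⟨(g.nnnorm : ℝ)⁻¹, hg', fun T' h => ?_⟩
  have happ : ApproximatesLinearOn T' T Set.univ ‖T' - T‖₊ := by
    intro x _ y _
    have := (T' - T).le_opNorm (x - y)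
    simpa using this
  have hs := happ.surjOn_closedBall_of_nonlinearRightInverse g (ε := 1) (b := 0) zero_le_one
    (Set.subset_univ _)
  have hpos : 0 < ((g.nnnorm : ℝ)⁻¹ - ‖T' - T‖₊) * 1 := by
    rw [mul_one, coe_nnnorm]; linarith
  have : T'.range = ⊤ := by
    apply Submodule.eq_top_of_nonempty_interior'
    refine ⟨0, mem_interior_iff_mem_nhds.2 (Filter.mem_of_superset
      (Metric.closedBall_mem_nhds 0 hpos) ?_)⟩
    intro z hz
    rw [map_zero] at hs
    obtain ⟨x, _, hx⟩ := hs hz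
    exact ⟨x, hx⟩
  exact LinearMap.range_eq_top.1 this

theorem dense_fg_aux {A M : Type*} [NormedCommRing A] [NormedAlgebra ℂ A] [CompleteSpace A]
    [NormedAddCommGroup M] [NormedSpace ℂ M] [CompleteSpace M] [Module A M] [IsBoundedSMul A M]
    [IsScalarTower ℂ A M] (s : ℕ → M) (hsum : Summable fun n => ‖s n‖)
    (hs : Submodule.span A (Set.range s) = ⊤)
    (N : Submodule A M) (hN : Dense (N : Set M)) :
    ∃ t : Finset M, (t : Set M) ⊆ N ∧ Submodule.span A (t : Set M) = ⊤ := by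
  classical
  let E := BoundedContinuousFunction ℕ A
  let S : ℕ → M → (E →L[ℂ] M) := fun n m =>
    ((ContinuousLinearMap.lsmul ℂ A).flip m).comp (BoundedContinuousFunction.evalCLM ℂ n)
  have hSa : ∀ n m (f : E), S n m f = f n • m := fun n m f => rfl
  have hSn : ∀ n m, ‖S n m‖ ≤ ‖m‖ := by
    intro n m
    refine ContinuousLinearMap.opNorm_le_bound _ (norm_nonneg _) fun f => ?_
    rw [hSa, mul_comm]
    refine (norm_smul_le _ _).trans ?_
    gcongr
    exact f.norm_coe_le_norm n
  have hSs : Summable fun n => S n (s n) :=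
    Summable.of_norm_bounded hsum fun n => hSn n _
  set T := ∑' n, S n (s n) with hTdef
  have hT : HasSum (fun n => S n (s n)) T := hSs.hasSum
  have hTa : ∀ f : E, HasSum (fun n => f n • s n) (T f) := fun f =>
    hT.mapL (ContinuousLinearMap.apply ℂ M f)
  have hsurj : Function.Surjective T := by
    intro m
    have hm : m ∈ Submodule.span A (Set.range s) := hs ▸ Submodule.mem_top
    rw [Finsupp.mem_span_range_iff_exists_finsupp] at hm
    obtain ⟨c, rfl⟩ := hm
    change _ ∈ T.range
    refine Submodule.sum_mem _ fun i _ => ?_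
    let f : E := BoundedContinuousFunction.ofNormedAddCommGroupDiscrete (Pi.single i (c i)) ‖c i‖
      (by
        intro n
        by_cases h : n = i
        · subst h; simp
        · simp [h])
    refine ⟨f, ?_⟩
    refine (hTa f).unique ?_
    have : f i • s i = c i • s i := by
      change (Pi.single i (c i) : ℕ → A) i • s i = _
      simp
    change HasSum _ (c i • s i)
    rw [← this]
    refine hasSum_single i fun n hn => ?_
    change (Pi.single i (c i) : ℕ → A) n • s n = _
    simp [hn]
  obtain ⟨ε, hε, hopen⟩ := surj_open T hsurj
  obtain ⟨k, hk⟩ := ((Metric.tendsto_atTop.1 hT.tendsto_sum_nat) (ε / 2) (half_pos hε))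
  have hk := hk k le_rfl
  have hδ : 0 < ε / (2 * (k + 1)) := by positivity
  have hy : ∀ n, ∃ y ∈ N, dist (s n) y < ε / (2 * (k + 1)) := fun n =>
    hN.exists_dist_lt (s n) hδ
  choose y hyN hyd using hy
  let T' := ∑ n ∈ Finset.range k, S n (y n)
  have hT' : Function.Surjective T' := by
    apply hopen
    have h1 : ‖T' - ∑ n ∈ Finset.range k, S n (s n)‖ ≤ k * (ε / (2 * (k + 1))) := by
      rw [← Finset.sum_sub_distrib]
      refine (norm_sum_le_of_le _ (f := fun n => S n (y n) - S n (s n))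
        (n := fun _ => ε / (2 * (k + 1))) ?_).trans ?_
      · intro n _
        have : S n (y n) - S n (s n) = S n (y n - s n) := by
          ext f
          simp [hSa, smul_sub]
        rw [this]
        refine (hSn _ _).trans ?_
        rw [← dist_eq_norm, dist_comm]
        exact (hyd n).le
      · simp
    have h2 : k * (ε / (2 * (k + 1))) ≤ ε / 2 := by
      have : (k:ℝ) * (ε / (2 * (k + 1))) = (ε / 2) * (k / (k + 1)) := by field_simp
      rw [this]
      apply mul_le_of_le_one_right (by positivity)
      rw [div_le_one (by positivity)]; linarith
    rw [dist_eq_norm] at hk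
    calc ‖T' - T‖ = ‖(T' - ∑ n ∈ Finset.range k, S n (s n))
          + (∑ n ∈ Finset.range k, S n (s n) - T)‖ := by congr 1; abel
      _ ≤ _ := norm_add_le _ _
      _ < ε := by linarith
  refine ⟨(Finset.range k).image y, ?_, ?_⟩
  · intro z hz
    simp only [Finset.coe_image, Set.mem_image] at hz
    obtain ⟨n, _, rfl⟩ := hz
    exact hyN n
  · rw [eq_top_iff]
    intro m _
    obtain ⟨f, rfl⟩ := hT' m
    have : T' f = ∑ n ∈ Finset.range k, f n • y n := by
      simp [T', hSa]
    rw [this]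
    refine Submodule.sum_mem _ fun n hn => Submodule.smul_mem _ _ (Submodule.subset_span ?_)
    exact Finset.mem_coe.2 (Finset.mem_image_of_mem _ hn)

theorem dense_fg {A M : Type*} [NormedCommRing A] [NormedAlgebra ℂ A] [CompleteSpace A]
    [NormedAddCommGroup M] [NormedSpace ℂ M] [CompleteSpace M] [Module A M] [IsBoundedSMul A M]
    [IsScalarTower ℂ A M] (s : ℕ → M)
    (hs : Submodule.span A (Set.range s) = ⊤)
    (N : Submodule A M) (hN : Dense (N : Set M)) :
    ∃ t : Finset M, (t : Set M) ⊆ N ∧ Submodule.span A (t : Set M) = ⊤ := by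
  let c : ℕ → ℝ := fun n => (1 / 2) ^ n / (1 + ‖s n‖)
  have hc : ∀ n, 0 < c n := fun n => by positivity
  refine dense_fg_aux (fun n => (c n : ℂ) • s n) ?_ ?_ N hN
  · refine Summable.of_nonneg_of_le (fun _ => norm_nonneg _) (fun n => ?_) summable_geometric_two
    rw [norm_smul, Complex.norm_real, Real.norm_of_nonneg (hc n).le]
    simp only [c]
    rw [div_mul_eq_mul_div, div_le_iff₀ (by positivity)]
    gcongr
    linarith
  · rw [eq_top_iff, ← hs, Submodule.span_le]
    rintro _ ⟨n, rfl⟩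
    have h0 : (c n : ℂ) ≠ 0 := by exact_mod_cast (hc n).ne'
    have : s n = (algebraMap ℂ A (c n : ℂ)⁻¹) • ((c n : ℂ) • s n) := by
      rw [algebraMap_smul, smul_smul, inv_mul_cancel₀ h0, one_smul]
    rw [this]
    exact Submodule.smul_mem _ _ (Submodule.subset_span ⟨n, rfl⟩)

/-- ideals version -/
theorem ideal_dense {A : Type*} [NormedCommRing A] [NormedAlgebra ℂ A] [CompleteSpace A]
    (K : Ideal A) (hK : IsClosed (K : Set A)) (S : Set A) (hS : S.Countable)
    (hKS : Ideal.span S = K) (J : Ideal A) (hJ : J ≤ K) (hJK : (K : Set A) ⊆ closure J) :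
    J = K ∧ K.FG := by
  classical
  have : IsBoundedSMul A K := IsBoundedSMul.of_norm_smul_le fun a k => norm_smul_le a (k : A)
  have : CompleteSpace K := hK.completeSpace_coe
  have hSK : ∀ x ∈ S, x ∈ K := fun x hx => hKS ▸ Ideal.subset_span hx
  obtain ⟨s, hs⟩ : ∃ s : ℕ → A, insert 0 S = Set.range s :=
    (hS.insert 0).exists_eq_range (Set.insert_nonempty _ _)
  have hsK : ∀ n, s n ∈ K := fun n => by
    have : s n ∈ insert 0 S := hs ▸ ⟨n, rfl⟩
    rcases this with h | h
    · rw [h]; exact K.zero_mem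
    · exact hSK _ h
  let s' : ℕ → K := fun n => ⟨s n, hsK n⟩
  have himg : ∀ (t : Set K), Submodule.map K.subtype (Submodule.span A t) = K →
      Submodule.span A t = ⊤ := by
    intro t h
    apply Submodule.map_injective_of_injective K.injective_subtype
    rw [h]; simp
  have hs' : Submodule.span A (Set.range s') = ⊤ := by
    apply himg
    rw [Submodule.map_span, ← Set.range_comp]
    have : (K.subtype ∘ s') = s := rfl
    rw [this, ← hs, Submodule.span_insert_zero]
    exact hKS
  have hd : Dense ((Submodule.comap K.subtype J : Submodule A K) : Set K) := by
    intro x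
    rw [Metric.mem_closure_iff]
    intro ε hε
    obtain ⟨b, hb, hbd⟩ := Metric.mem_closure_iff.1 (hJK x.2) ε hε
    exact ⟨⟨b, hJ hb⟩, hb, hbd⟩
  obtain ⟨t, ht, htop⟩ := dense_fg s' hs' _ hd
  have hspan : Submodule.span A (K.subtype '' (t : Set K)) = K := by
    rw [← Submodule.map_span, htop]; simp
  refine ⟨le_antisymm hJ ?_, ?_⟩
  · rw [← hspan, Submodule.span_le]
    rintro _ ⟨x, hx, rfl⟩
    exact ht hx
  · exact ⟨t.image K.subtype, by rw [Finset.coe_image]; exact hspan⟩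

theorem unit_of_limit {B : Type*} [NormedCommRing B] [NormedAlgebra ℂ B] [CompleteSpace B]
    [IsDomain B] (hcl : ∀ b : B, IsClosed ((Ideal.span {b} : Ideal B) : Set B))
    (b : B) (hb : b ≠ 0) (hlim : b ∈ closure {u : B | IsUnit u}) : IsUnit b := by
  let f : B →L[ℂ] B := ContinuousLinearMap.mul ℂ B b
  have hf : ∀ x, f x = b * x := fun x => rfl
  have hinj : Function.Injective f := fun x y h => mul_left_cancel₀ hb h
  have hrange : Set.range f = ((Ideal.span {b} : Ideal B) : Set B) := by
    ext x
    simp only [Set.mem_range, hf, SetLike.mem_coe, Ideal.mem_span_singleton, Dvd.dvd, eq_comm]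
  obtain ⟨K, hK⟩ := f.antilipschitz_of_injective_of_isClosed_range hinj (hrange ▸ hcl b)
  have hK' : ∀ x, ‖x‖ ≤ K * ‖b * x‖ := fun x => by
    simpa [hf] using hK.le_mul_dist x 0
  rw [← Ideal.span_singleton_eq_top, Ideal.eq_top_iff_one]
  have hmem : (1 : B) ∈ closure ((Ideal.span {b} : Ideal B) : Set B) := by
    rw [Metric.mem_closure_iff]
    intro ε hε
    have hK0 : (0:ℝ) ≤ K := K.2
    have h1 : 0 ≤ ‖(1:B)‖ := norm_nonneg _
    obtain ⟨u, hu, hd⟩ := Metric.mem_closure_iff.1 hlim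
      (min (1 / (2 * (K + 1))) (ε / (2 * (K + 1) * (‖(1:B)‖ + 1)))) (by positivity)
    obtain ⟨v, rfl⟩ := hu
    rw [dist_eq_norm] at hd
    have hd1 := hd.trans_le (min_le_left _ _)
    have hd2 := hd.trans_le (min_le_right _ _)
    set x : B := ((v⁻¹ : Bˣ) : B) with hx
    set d := ‖b - v‖ with hdd
    have hd0 : 0 ≤ d := norm_nonneg _
    have hx0 : 0 ≤ ‖x‖ := norm_nonneg _
    have hbx : b * x = 1 + (b - v) * x := by
      rw [sub_mul, hx, Units.mul_inv]; ring
    have hdx : ‖(b - v) * x‖ ≤ d * ‖x‖ := norm_mul_le _ _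
    have hbx' : ‖b * x‖ ≤ ‖(1:B)‖ + d * ‖x‖ := by
      rw [hbx]; exact (norm_add_le _ _).trans (by linarith)
    have hxb : ‖x‖ ≤ K * (‖(1:B)‖ + d * ‖x‖) :=
      (hK' x).trans (mul_le_mul_of_nonneg_left hbx' hK0)
    rw [lt_div_iff₀ (by positivity)] at hd1 hd2
    have hKd : K * d ≤ 1 / 2 := by nlinarith
    have hx2 : ‖x‖ ≤ 2 * K * ‖(1:B)‖ := by
      have : K * d * ‖x‖ ≤ 1 / 2 * ‖x‖ := mul_le_mul_of_nonneg_right hKd hx0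
      nlinarith
    refine ⟨b * x, Ideal.mul_mem_right _ _ (Ideal.mem_span_singleton_self b), ?_⟩
    rw [dist_comm, dist_eq_norm, hbx, add_sub_cancel_left]
    calc _ ≤ d * ‖x‖ := hdx
      _ ≤ d * (2 * K * ‖(1:B)‖) := by gcongr
      _ ≤ d * (2 * (K + 1) * (‖(1:B)‖ + 1)) := by gcongr <;> linarith
      _ < ε := hd2
  rwa [(hcl b).closure_eq] at hmem

theorem domain_scalar {B : Type*} [NormedCommRing B] [NormedAlgebra ℂ B] [CompleteSpace B]
    [IsDomain B] (hcl : ∀ b : B, IsClosed ((Ideal.span {b} : Ideal B) : Set B))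
    (a : B) : ∃ z : ℂ, algebraMap ℂ B z = a := by
  by_contra! hne
  have hclosed : IsClosed (resolventSet ℂ a) := by
    rw [← closure_subset_iff_isClosed]
    intro z hz
    rw [spectrum.mem_resolventSet_iff]
    apply unit_of_limit hcl _ (sub_ne_zero.2 (hne z))
    have hcont : Continuous fun z : ℂ => algebraMap ℂ B z - a := by fun_prop
    exact map_mem_closure (f := fun z : ℂ => algebraMap ℂ B z - a) hcont hz fun w hw => spectrum.mem_resolventSet_iff.1 hw
  have hclopen : IsClopen (resolventSet ℂ a) := ⟨hclosed, spectrum.isOpen_resolventSet a⟩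
  obtain ⟨z, hz⟩ := spectrum.nonempty a
  have hnon : (resolventSet ℂ a).Nonempty := by
    by_contra hemp
    rw [Set.not_nonempty_iff_eq_empty] at hemp
    have h : spectrum ℂ a = Set.univ := by
      rw [spectrum, hemp, Set.compl_empty]
    exact noncompact_univ ℂ (h ▸ spectrum.isCompact a)
  exact hz (hclopen.eq_univ hnon ▸ Set.mem_univ z)

theorem prime_scalar {A : Type*} [NormedCommRing A] [NormedAlgebra ℂ A] [CompleteSpace A]
    (P : Ideal A) [P.IsPrime] (hcl : ∀ J : Ideal A, P ≤ J → IsClosed (J : Set A)) (a : A) :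
    ∃ z : ℂ, a - algebraMap ℂ A z ∈ P := by
  have : IsClosed (P : Set A) := hcl P le_rfl
  obtain ⟨z, hz⟩ := domain_scalar (B := A ⧸ P) (fun b => by
    have hq := (QuotientRing.isOpenQuotientMap_mk P).isQuotientMap
    refine hq.isClosed_preimage.1 ?_
    refine hcl ((Ideal.span {b}).comap (Ideal.Quotient.mk P)) ?_
    intro x hx
    rw [Ideal.mem_comap, Ideal.Quotient.eq_zero_iff_mem.2 hx]
    exact zero_mem _) (Ideal.Quotient.mk P a)
  refine ⟨z, ?_⟩
  rw [← Ideal.Quotient.eq, ← hz]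
  rfl

theorem closed_of_closure_fg {A : Type*} [NormedCommRing A] [NormedAlgebra ℂ A] [CompleteSpace A]
    (J : Ideal A) (h : J.closure.FG) : IsClosed (J : Set A) := by
  obtain ⟨t, ht⟩ := h
  have hc : IsClosed (J.closure : Set A) := by
    rw [Ideal.coe_closure]; exact isClosed_closure
  have := (ideal_dense J.closure hc t t.countable_toSet ht J
    (fun x hx => subset_closure hx) (by rw [Ideal.coe_closure])).1
  rw [this]; exact hc

theorem all_fg {A : Type*} [NormedCommRing A] [NormedAlgebra ℂ A] [CompleteSpace A]
    (hmax : ∀ M : Submodule ℂ A, IsMaxLeftIdeal M → IsCGLeftIdeal M) (I : Ideal A) : I.FG := by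
  by_contra hI
  obtain ⟨M, -, hM⟩ : ∃ M, I ≤ M ∧ Maximal (fun J : Ideal A => ¬ J.FG) M := by
    refine zorn_le_nonempty₀ {I : Ideal A | ¬ I.FG}
      (fun C hC₁ hC₂ J hJ => ⟨sSup C, ?_, fun _ => le_sSup⟩) I hI
    rintro ⟨G, hG⟩
    obtain ⟨J', J_mem_C, G_subset_J⟩ : ∃ J ∈ C, (G : Set A) ⊆ J := by
      refine hC₂.directedOn.exists_mem_subset_of_finset_subset_biUnion ⟨J, hJ⟩ (fun _ hx => ?_)
      simp only [Set.mem_iUnion, SetLike.mem_coe, exists_prop]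
      exact (Submodule.mem_sSup_of_directed ⟨J, hJ⟩ hC₂.directedOn).1
        (hG ▸ Submodule.subset_span hx)
    have : J' = sSup C := le_antisymm (le_sSup J_mem_C) (hG ▸ Ideal.span_le.2 G_subset_J)
    exact hC₁ J_mem_C (this ▸ ⟨G, hG⟩)
  have hprime : M.IsPrime := Ideal.isOka_fg.isPrime_of_maximal_not hM
  have hcl : ∀ J : Ideal A, M ≤ J → IsClosed (J : Set A) := by
    intro J hJ
    by_cases h : J.closure.FG
    · exact closed_of_closure_fg J h
    · have hJc : J ≤ J.closure := fun x hx => subset_closure hx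
      have h2 : J.closure ≤ M := hM.2 h (hJ.trans hJc)
      have h3 : J.closure = J := le_antisymm (h2.trans hJ) hJc
      rw [← h3, Ideal.coe_closure]; exact isClosed_closure
  have hsc := prime_scalar M hcl
  have hML : IsMaxLeftIdeal (M.restrictScalars ℂ) := by
    refine ⟨fun a x hx => M.mul_mem_left a hx, ?_, ?_⟩
    · intro h
      apply hprime.ne_top
      rw [Ideal.eq_top_iff_one]
      have : (1 : A) ∈ M.restrictScalars ℂ := h ▸ Submodule.mem_top
      exact this
    · intro J hJ hlt
      obtain ⟨hle, x, hxJ, hxM⟩ := SetLike.lt_iff_le_and_exists.1 hlt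
      obtain ⟨z, hz⟩ := hsc x
      have hz0 : z ≠ 0 := by
        rintro rfl
        apply hxM
        simpa using hz
      have h1 : algebraMap ℂ A z ∈ J := by
        have := J.sub_mem hxJ (hle (show x - algebraMap ℂ A z ∈ M.restrictScalars ℂ from hz))
        simpa using this
      rw [eq_top_iff]
      intro y _
      have := hJ (y * algebraMap ℂ A z⁻¹) _ h1
      rwa [mul_assoc, ← map_mul, inv_mul_cancel₀ hz0, map_one, mul_one] at this
  obtain ⟨S, hS, hSM, hgen⟩ := hmax _ hML
  have hspan : Ideal.span S = M := by
    apply le_antisymm (Ideal.span_le.2 hSM)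
    intro x hx
    have hx' : x ∈ leftIdealGen S := hgen ▸ hx
    have hle : leftIdealGen S ≤ (Ideal.span S).restrictScalars ℂ :=
      sInf_le ⟨fun a x hx => (Ideal.span S).mul_mem_left a hx, Ideal.subset_span⟩
    exact hle hx'
  exact hM.1 (ideal_dense M (hcl M le_rfl) S hS hspan M le_rfl subset_closure).2

theorem oka_cofin (A : Type*) [CommRing A] [Algebra ℂ A] :
    Ideal.IsOka fun I : Ideal A => ∃ V : Submodule ℂ A, V.FG ∧ ∀ x, ∃ v ∈ V, x - v ∈ I where
  top := ⟨⊥, Submodule.fg_bot, fun x => ⟨0, zero_mem _, Submodule.mem_top⟩⟩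
  oka := by
    rintro I a ⟨V, hV, h⟩ ⟨W, hW, h'⟩
    refine ⟨V ⊔ W.map (LinearMap.mulRight ℂ a), hV.sup (hW.map _), fun x => ?_⟩
    obtain ⟨v, hv, hx⟩ := h x
    obtain ⟨i, hi, y, hy, hxy⟩ := Submodule.mem_sup.1 hx
    obtain ⟨c, rfl⟩ := Ideal.mem_span_singleton'.1 hy
    obtain ⟨w, hw, hcw⟩ := h' c
    refine ⟨v + w * a, Submodule.add_mem_sup hv ⟨w, hw, rfl⟩, ?_⟩
    have h1 : (c - w) * a ∈ I := Ideal.mem_colon_span_singleton.1 hcw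
    have : x - (v + w * a) = i + (c - w) * a := by linear_combination -hxy
    rw [this]
    exact I.add_mem hi h1

/-- Theorem 3.2. Let `A` be a commutative, unital Banach algebra in
which every maximal ideal is countably generated. Then `A` is finite-dimensional. -/
theorem finiteDimensional_of_maximal_cg {A : Type*} [NormedCommRing A]
    [NormedAlgebra ℂ A] [CompleteSpace A]
    (hmax : ∀ M : Submodule ℂ A, IsMaxLeftIdeal M → IsCGLeftIdeal M) :
    FiniteDimensional ℂ A := by
  have hfg := all_fg hmax
  have hN : IsNoetherianRing A := ⟨hfg⟩
  have hcl : ∀ J : Ideal A, IsClosed (J : Set A) := fun J => closed_of_closure_fg J (hfg _)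
  obtain ⟨V, hV, h⟩ := (oka_cofin A).forall_of_forall_prime
    (fun I hI => by
      obtain ⟨M, hM, hmx⟩ := set_has_maximal_iff_noetherian.2 hN
        {I : Ideal A | ¬ ∃ V : Submodule ℂ A, V.FG ∧ ∀ x, ∃ v ∈ V, x - v ∈ I} ⟨I, hI⟩
      exact ⟨M, hM, fun J hJ hMJ => by
        by_contra hJM
        exact hmx J hJ (lt_of_le_not_ge hMJ hJM)⟩)
    (fun P hP => by
      refine ⟨Submodule.span ℂ {1}, Submodule.fg_span_singleton 1, fun x => ?_⟩
      obtain ⟨z, hz⟩ := prime_scalar P (fun J _ => hcl J) x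
      refine ⟨algebraMap ℂ A z, ?_, hz⟩
      rw [Algebra.algebraMap_eq_smul_one]
      exact Submodule.smul_mem _ _ (Submodule.mem_span_singleton_self 1)) ⊥
  have hVt : V = ⊤ := by
    rw [eq_top_iff]
    intro x _
    obtain ⟨v, hv, hx⟩ := h x
    rw [Ideal.mem_bot, sub_eq_zero] at hx
    rwa [hx]
  exact ⟨hVt ▸ hV⟩
end
end
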